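/- Suppose the signal fully reveals the state, i.e., S = Ω and f is the identity map. Then the asymptotic value function is constant in the stage duration: V(h) = V(1) for all h ∈ (0,1], where V(h) := sup_σ R(σ, h). -/

import Mathlib

open Filter

/-- A POMDP (data only): deterministic signal map `f`, stage payoff `g`,
transition kernel `P`, and initial distribution `p1`. -/
structure POMDP (Ω A S : Type*) where
  f : Ω → S
  g : Ω → A → ℝ
  P : Ω → A → Ω → ℝ
  p1 : Ω → ℝ

/-- A history `(s₁, a₁, …, a_{t-1}, s_t)`, encoded as the reversed list of past
(signal, action) pairs together with the current signal. -/
abbrev Hist (S A : Type*) := List (S × A) × S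

/-- A behavior strategy (data only): a mixed action for every finite history. -/
abbrev Strategy (S A : Type*) := Hist S A → A → ℝ

/-- `σ η ∈ Δ(A)` for every history `η`. -/
def IsStrategy {S A : Type*} [Fintype A] (σ : Strategy S A) : Prop :=
  (∀ η a, 0 ≤ σ η a) ∧ ∀ η, ∑ a, σ η a = 1

namespace POMDP

variable {Ω A S : Type*} [Fintype Ω] [Fintype A]

/-- `P ω a ∈ Δ(Ω)` for every `(ω, a)`, and `p1 ∈ Δ(Ω)`. -/
def IsValid (M : POMDP Ω A S) : Prop :=
  (∀ ω a ω', 0 ≤ M.P ω a ω') ∧ (∀ ω a, ∑ ω', M.P ω a ω' = 1) ∧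
    (∀ ω, 0 ≤ M.p1 ω) ∧ ∑ ω, M.p1 ω = 1

/-- The observable history determined by a reversed past trajectory and the
current state. -/
def obs (M : POMDP Ω A S) (rev : List (Ω × A)) (ω : Ω) : Hist S A :=
  (rev.map fun p => (M.f p.1, p.2), M.f ω)

/-- Probability of a finite trajectory `(ω₁, a₁, …, ω_t, a_t)` under a strategy,
the trajectory being given in reverse order (the head of the list is the most
recent (state, action) pair). -/
def trajP (M : POMDP Ω A S) (σ : Strategy S A) : List (Ω × A) → ℝ
  | [] => 1
  | (ω, a) :: rest =>
      (match rest with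
        | [] => M.p1 ω
        | (ω', a') :: _ => M.P ω' a' ω) *
        σ (M.obs rest ω) a * trajP M σ rest

/-- The expected stage-`(n+1)` payoff `E_σ[g(ω_{n+1}, a_{n+1})]`. -/
noncomputable def stageE (M : POMDP Ω A S) (σ : Strategy S A) (n : ℕ) : ℝ :=
  ∑ tr : Fin (n + 1) → Ω × A, trajP M σ (List.ofFn tr) * M.g (tr 0).1 (tr 0).2

/-- The expected long-run average payoff
`R(σ) = liminf_T E_σ[(1/T) ∑_{i=1}^T g(ω_i, a_i)]`. -/
noncomputable def R (M : POMDP Ω A S) (σ : Strategy S A) : ℝ :=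
  liminf (fun T : ℕ => (1 / (T : ℝ)) * ∑ n ∈ Finset.range T, stageE M σ n) atTop

/-- The POMDP `G_h` with stage duration `h`:
`P_h(⬝|ω,a) = h·P(⬝|ω,a) + (1-h)·δ_ω`. -/
def dur [DecidableEq Ω] (M : POMDP Ω A S) (h : ℝ) : POMDP Ω A S :=
  { M with P := fun ω a ω' => h * M.P ω a ω' + (1 - h) * (if ω' = ω then 1 else 0) }

/-- The asymptotic value `V(h) = sup_σ R(σ, h)` of `G_h`. -/
noncomputable def V [DecidableEq Ω] (M : POMDP Ω A S) (h : ℝ) : ℝ :=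
  sSup {r | ∃ σ : Strategy S A, IsStrategy σ ∧ r = (M.dur h).R σ}

end POMDP

/-- A finite-dimensional space is spanned by the fixed vectors of a linear contraction `L` and the
range of `1 - L`. -/
theorem exists_fixed_add_coboundary {E : Type*} [NormedAddCommGroup E] [NormedSpace ℝ E]
    [FiniteDimensional ℝ E] (L : E →ₗ[ℝ] E) (hL : ∀ x, ‖L x‖ ≤ ‖x‖) (x : E) :
    ∃ v y, L v = v ∧ x = v + (y - L y) := by
  set N : E →ₗ[ℝ] E := LinearMap.id - L with hN
  have hdisj : Disjoint (LinearMap.ker N) (LinearMap.range N) := by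
    rw [Submodule.disjoint_def]
    rintro z hz ⟨y, rfl⟩
    have hfix : L (N y) = N y := by
      have : N y - L (N y) = 0 := by simpa [hN] using hz
      exact (sub_eq_zero.mp this).symm
    have hiter : ∀ n : ℕ, (L^[n]) y = y - (n : ℝ) • N y := by
      intro n
      induction n with
      | zero => simp
      | succ n ih =>
        rw [Function.iterate_succ_apply', ih, map_sub, map_smul, hfix]
        have : L y = y - N y := by simp [hN]
        rw [this]
        push_cast
        module
    have hbound : ∀ n : ℕ, ‖(L^[n]) y‖ ≤ ‖y‖ := by
      intro n
      induction n with
      | zero => simp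
      | succ n ih =>
        rw [Function.iterate_succ_apply']
        exact (hL _).trans ih
    by_contra hne
    have hpos : 0 < ‖N y‖ := norm_pos_iff.mpr hne
    obtain ⟨n, hn⟩ := exists_nat_gt (2 * ‖y‖ / ‖N y‖)
    rw [div_lt_iff₀ hpos] at hn
    have h1 : (n : ℝ) • N y = y - (L^[n]) y := by rw [hiter]; abel
    have h2 : (n : ℝ) * ‖N y‖ ≤ ‖y‖ + ‖y‖ := by
      calc (n : ℝ) * ‖N y‖ = ‖(n : ℝ) • N y‖ := by simp [norm_smul]
        _ ≤ ‖y‖ + ‖(L^[n]) y‖ := by rw [h1]; exact norm_sub_le _ _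
        _ ≤ ‖y‖ + ‖y‖ := by gcongr; exact hbound n
    linarith
  have htop : LinearMap.ker N ⊔ LinearMap.range N = ⊤ := by
    apply Submodule.eq_top_of_disjoint _ _ _ hdisj
    rw [add_comm]
    exact (LinearMap.finrank_range_add_finrank_ker N).ge
  obtain ⟨v, hv, _, ⟨y, rfl⟩, hvy⟩ := Submodule.mem_sup.mp (htop ▸ Submodule.mem_top (x := x))
  refine ⟨v, y, ?_, ?_⟩
  · have : v - L v = 0 := by simpa [hN] using hv
    exact (sub_eq_zero.mp this).symm
  · rw [← hvy]; simp [hN]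

/-- Truncated Laurent expansion, as `β → 1`, of the solution of `W = g + β • L W` for a linear
contraction `L`. -/
theorem exists_resolvent_expansion {E : Type*} [NormedAddCommGroup E] [NormedSpace ℝ E]
    [FiniteDimensional ℝ E] (L : E →ₗ[ℝ] E) (hL : ∀ x, ‖L x‖ ≤ ‖x‖) (g : E) :
    ∃ (v u : E) (C : ℝ), L v = v ∧ v + u = g + L u ∧
      ∀ ε : ℝ, 0 < ε → ε < 1 → ∀ W : E, W = g + (1 - ε) • L W →
        ‖W - (ε⁻¹ • v + u)‖ ≤ C * ε := by
  obtain ⟨v, y, hv, hg⟩ := exists_fixed_add_coboundary L hL g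
  obtain ⟨y', w, hy', hy⟩ := exists_fixed_add_coboundary L hL y
  have hyu : y - L y = (w - L w) - L (w - L w) := by
    rw [hy, map_add, hy']; abel
  refine ⟨v, w - L w, ‖L (L w)‖ + ‖L w‖, hv, ?_, ?_⟩
  · rw [hg, hyu]; abel
  · intro ε hε hε1 W hW
    set D : E := W - (ε⁻¹ • v + (w - L w)) + ε • L w with hD
    have hDeq : D = (1 - ε) • L D + (ε * ε) • L (L w) := by
      have hεv : ε⁻¹ • v = v + (1 - ε) • (ε⁻¹ • v) := by
        rw [smul_smul, sub_mul, one_mul, mul_inv_cancel₀ hε.ne']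
        module
      have hLD : L D = L W - (ε⁻¹ • v + (L w - L (L w))) + ε • L (L w) := by
        simp [hD, hv]
      rw [hLD, hD]
      nth_rewrite 1 [hW]
      rw [hg, hyu]
      nth_rewrite 1 [hεv]
      simp only [map_sub]
      module
    have hDn : ‖D‖ ≤ (1 - ε) * ‖D‖ + ε * ε * ‖L (L w)‖ := by
      calc ‖D‖ = ‖(1 - ε) • L D + (ε * ε) • L (L w)‖ := by rw [← hDeq]
        _ ≤ ‖(1 - ε) • L D‖ + ‖(ε * ε) • L (L w)‖ := norm_add_le _ _
        _ = (1 - ε) * ‖L D‖ + ε * ε * ‖L (L w)‖ := by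
          rw [norm_smul, norm_smul, Real.norm_of_nonneg (by linarith),
            Real.norm_of_nonneg (by positivity)]
        _ ≤ _ := by
          have h1 : 0 ≤ 1 - ε := by linarith
          have h2 := hL D
          gcongr
    have hDε : ‖D‖ ≤ ε * ‖L (L w)‖ := by
      refine le_of_mul_le_mul_left ?_ hε
      linarith
    calc ‖W - (ε⁻¹ • v + (w - L w))‖ = ‖D - ε • L w‖ := by rw [hD]; congr 1; abel
      _ ≤ ‖D‖ + ‖ε • L w‖ := norm_sub_le _ _
      _ ≤ ε * ‖L (L w)‖ + ε * ‖L w‖ := by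
        rw [norm_smul, Real.norm_of_nonneg hε.le]; gcongr
      _ = _ := by ring

namespace POMDP

section Bellman

variable {Ω A S : Type*} [Fintype Ω]

/-- Conditional expectation of `F` at the next state, given the current state and action. -/
def next (M : POMDP Ω A S) (F : Ω → ℝ) (ω : Ω) (a : A) : ℝ :=
  ∑ ω', M.P ω a ω' * F ω'

theorem next_add (M : POMDP Ω A S) (F G : Ω → ℝ) (ω : Ω) (a : A) :
    M.next (F + G) ω a = M.next F ω a + M.next G ω a := by
  simp [next, mul_add, Finset.sum_add_distrib]

theorem next_smul (M : POMDP Ω A S) (c : ℝ) (F : Ω → ℝ) (ω : Ω) (a : A) :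
    M.next (c • F) ω a = c * M.next F ω a := by
  simp only [next, Pi.smul_apply, smul_eq_mul, Finset.mul_sum]
  exact Finset.sum_congr rfl fun _ _ => by ring

theorem IsValid.abs_next_le {M : POMDP Ω A S} (hM : M.IsValid) (F : Ω → ℝ) (ω : Ω) (a : A) :
    |M.next F ω a| ≤ ‖F‖ := by
  calc |M.next F ω a| ≤ ∑ ω', |M.P ω a ω' * F ω'| := Finset.abs_sum_le_sum_abs _ _
    _ ≤ ∑ ω', M.P ω a ω' * ‖F‖ := by
      refine Finset.sum_le_sum fun ω' _ => ?_
      rw [abs_mul, abs_of_nonneg (hM.1 ω a ω')]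
      exact mul_le_mul_of_nonneg_left (norm_le_pi_norm F ω') (hM.1 ω a ω')
    _ = ‖F‖ := by rw [← Finset.sum_mul, hM.2.1, one_mul]

/-- The linear map `F ↦ P_d F` attached to a stationary policy `d`. -/
def policyMap (M : POMDP Ω A S) (d : Ω → A) : (Ω → ℝ) →ₗ[ℝ] (Ω → ℝ) where
  toFun F ω := M.next F ω (d ω)
  map_add' F G := funext fun ω => M.next_add F G ω (d ω)
  map_smul' c F := funext fun ω => M.next_smul c F ω (d ω)

theorem IsValid.norm_policyMap_le {M : POMDP Ω A S} (hM : M.IsValid) (d : Ω → A) (F : Ω → ℝ) :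
    ‖M.policyMap d F‖ ≤ ‖F‖ :=
  (pi_norm_le_iff_of_nonneg (norm_nonneg F)).mpr fun ω => hM.abs_next_le F ω (d ω)

theorem next_dur [DecidableEq Ω] (M : POMDP Ω A S) (h : ℝ) (F : Ω → ℝ) (ω : Ω) (a : A) :
    (M.dur h).next F ω a = h * M.next F ω a + (1 - h) * F ω := by
  simp [next, dur, add_mul, Finset.sum_add_distrib, Finset.mul_sum, mul_assoc]

theorem IsValid.dur [DecidableEq Ω] {M : POMDP Ω A S} (hM : M.IsValid) {h : ℝ} (hh : h ∈ Set.Ioc (0 : ℝ) 1) :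
    (M.dur h).IsValid := by
  refine ⟨fun ω a ω' => ?_, fun ω a => ?_, hM.2.2.1, hM.2.2.2⟩
  · have h1 := hM.1 ω a ω'
    have h2 : 0 ≤ 1 - h := by linarith [hh.2]
    have h3 := hh.1.le
    simp only [POMDP.dur]
    positivity
  · simp [POMDP.dur, Finset.sum_add_distrib, ← Finset.mul_sum, hM.2.1]

/-- `(v, u, d)` solves the average-payoff optimality equations: `v` and `u` satisfy the
optimality inequalities for all actions, with equality along the stationary policy `d`. -/
structure IsAverageSolution (M : POMDP Ω A S) (v u : Ω → ℝ) (d : Ω → A) : Prop where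
  next_le : ∀ ω a, M.next v ω a ≤ v ω
  add_next_le : ∀ ω a, M.g ω a + M.next u ω a ≤ v ω + u ω
  next_eq : ∀ ω, M.next v ω (d ω) = v ω
  add_next_eq : ∀ ω, M.g ω (d ω) + M.next u ω (d ω) = v ω + u ω

/-- The optimality equations are invariant under a change of stage duration, up to scaling of the
relative value. -/
theorem IsAverageSolution.dur [DecidableEq Ω] {M : POMDP Ω A S} {v u : Ω → ℝ} {d : Ω → A}
    (hs : M.IsAverageSolution v u d) {h : ℝ} (hh : 0 < h) :
    (M.dur h).IsAverageSolution v (h⁻¹ • u) d := by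
  have hg : (M.dur h).g = M.g := rfl
  refine ⟨fun ω a => ?_, fun ω a => ?_, fun ω => ?_, fun ω => ?_⟩
  · rw [next_dur]
    nlinarith [hs.next_le ω a]
  · rw [next_dur, next_smul, mul_inv_cancel_left₀ hh.ne', hg]
    simp only [Pi.smul_apply, smul_eq_mul, sub_mul, one_mul, mul_inv_cancel_left₀ hh.ne']
    linarith [hs.add_next_le ω a]
  · rw [next_dur, hs.next_eq]
    ring
  · rw [next_dur, next_smul, mul_inv_cancel_left₀ hh.ne', hg]
    simp only [Pi.smul_apply, smul_eq_mul, sub_mul, one_mul, mul_inv_cancel_left₀ hh.ne']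
    linarith [hs.add_next_eq ω]

variable [Fintype A]

/-- The discounted optimality equation has a solution, attained by a stationary policy. -/
theorem IsValid.exists_discounted_optimal [Nonempty A] {M : POMDP Ω A S} (hM : M.IsValid)
    {β : ℝ} (hβ0 : 0 ≤ β) (hβ1 : β < 1) :
    ∃ (W : Ω → ℝ) (d : Ω → A), (∀ ω a, M.g ω a + β * M.next W ω a ≤ W ω) ∧
      ∀ ω, W ω = M.g ω (d ω) + β * M.next W ω (d ω) := by
  let T : (Ω → ℝ) → (Ω → ℝ) := fun W ω =>
    Finset.univ.sup' Finset.univ_nonempty fun a => M.g ω a + β * M.next W ω a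
  have hle : ∀ W W' ω, T W ω ≤ T W' ω + β * dist W W' := by
    intro W W' ω
    refine Finset.sup'_le _ _ fun a _ => ?_
    have h1 : M.next W ω a ≤ M.next W' ω a + dist W W' := by
      have h2 := hM.abs_next_le (W - W') ω a
      have h3 : M.next W ω a = M.next W' ω a + M.next (W - W') ω a := by
        rw [← next_add]; simp
      rw [dist_eq_norm, h3]
      linarith [le_abs_self (M.next (W - W') ω a)]
    have h4 : M.g ω a + β * M.next W' ω a ≤ T W' ω :=
      Finset.le_sup' (fun a => M.g ω a + β * M.next W' ω a) (Finset.mem_univ a)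
    nlinarith [mul_le_mul_of_nonneg_left h1 hβ0]
  have hT : ContractingWith ⟨β, hβ0⟩ T := by
    refine ⟨by exact_mod_cast hβ1, LipschitzWith.of_dist_le_mul fun W W' => ?_⟩
    refine (dist_pi_le_iff (by positivity)).mpr fun ω => ?_
    rw [Real.dist_eq, abs_sub_le_iff]
    have h1 := hle W W' ω
    have h2 := hle W' W ω
    rw [dist_comm W' W] at h2
    change _ ≤ β * dist W W' ∧ _ ≤ β * dist W W'
    constructor <;> linarith
  have hfix : T hT.fixedPoint = hT.fixedPoint := hT.fixedPoint_isFixedPt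
  set W := hT.fixedPoint
  have harg : ∀ ω, ∃ a, W ω = M.g ω a + β * M.next W ω a := by
    intro ω
    obtain ⟨a, -, ha⟩ := Finset.exists_mem_eq_sup' Finset.univ_nonempty
      fun a => M.g ω a + β * M.next W ω a
    exact ⟨a, (congrFun hfix ω).symm.trans ha⟩
  choose d hd using harg
  refine ⟨W, d, fun ω a => ?_, hd⟩
  conv_rhs => rw [← hfix]
  exact Finset.le_sup' (fun a => M.g ω a + β * M.next W ω a) (Finset.mem_univ a)

theorem IsValid.exists_isAverageSolution [Nonempty A] {M : POMDP Ω A S} (hM : M.IsValid) :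
    ∃ v u d, M.IsAverageSolution v u d := by
  let ε : ℕ → ℝ := fun k => 1 / ((k : ℝ) + 2)
  have hε0 : ∀ k, 0 < ε k := fun k => by positivity
  have hε1 : ∀ k, ε k < 1 := fun k => by
    rw [div_lt_one (by positivity)]
    have : (0 : ℝ) ≤ k := k.cast_nonneg
    linarith
  have hεlim : Tendsto ε atTop (nhds 0) :=
    tendsto_const_nhds.div_atTop (tendsto_atTop_add_const_right _ _ tendsto_natCast_atTop_atTop)
  have hdisc := fun k => hM.exists_discounted_optimal (β := 1 - ε k)
    (by linarith [hε1 k]) (by linarith [hε0 k])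
  choose W D hWle hWeq using hdisc
  obtain ⟨d, hd⟩ := Finite.exists_infinite_fiber D
  have hfreq : ∃ᶠ k in atTop, D k = d :=
    Nat.frequently_atTop_iff_infinite.mpr (Set.infinite_coe_iff.mp hd)
  obtain ⟨v, u, C, hv, hu, hC⟩ := exists_resolvent_expansion (M.policyMap d)
    (hM.norm_policyMap_le d) (fun ω => M.g ω (d ω))
  have hkey : ∀ ω a, ∃ᶠ k in atTop, 0 ≤ (v ω - M.next v ω a) +
      (M.next v ω a + u ω - M.g ω a - M.next u ω a) * ε k +
        (M.next u ω a + 2 * C) * (ε k * ε k) := by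
    intro ω a
    refine hfreq.mono fun k hk => ?_
    have hpos := hε0 k
    have hlt := hε1 k
    have hr := hC (ε k) hpos hlt (W k) (funext fun ω => by
      simpa [hk, policyMap] using hWeq k ω)
    set r := W k - ((ε k)⁻¹ • v + u) with hrdef
    have hW : W k = (ε k)⁻¹ • v + u + r := by rw [hrdef]; abel
    have h1 := hWle k ω a
    rw [hW, next_add, next_add, next_smul] at h1
    simp only [Pi.add_apply, Pi.smul_apply, smul_eq_mul] at h1
    have h2 : r ω ≤ C * ε k := (le_abs_self _).trans ((norm_le_pi_norm r ω).trans hr)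
    have h3 : -M.next r ω a ≤ C * ε k :=
      (neg_le_abs _).trans ((hM.abs_next_le r ω a).trans hr)
    have h4 : -((1 - ε k) * M.next r ω a) ≤ C * ε k := by
      have hC0 : 0 ≤ C * ε k := (norm_nonneg _).trans hr
      nlinarith [mul_le_mul_of_nonneg_left h3 (sub_nonneg.mpr hlt.le), mul_nonneg hpos.le hC0]
    have h5 : 0 ≤ (ε k)⁻¹ * (v ω - M.next v ω a) + (ε k)⁻¹ * ε k * M.next v ω a
        + u ω - M.g ω a - M.next u ω a + ε k * M.next u ω a + 2 * (C * ε k) := by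
      linarith
    rw [inv_mul_cancel₀ hpos.ne'] at h5
    have h6 := mul_nonneg hpos.le h5
    have h7 : ε k * ((ε k)⁻¹ * (v ω - M.next v ω a)) = v ω - M.next v ω a := by
      rw [← mul_assoc, mul_inv_cancel₀ hpos.ne', one_mul]
    linarith
  have hvle : ∀ ω a, 0 ≤ v ω - M.next v ω a := by
    intro ω a
    refine ge_of_tendsto_of_frequently (f := fun k => _) ?_ (hkey ω a)
    simpa using (tendsto_const_nhds.add (hεlim.const_mul _)).add
      ((hεlim.mul hεlim).const_mul (M.next u ω a + 2 * C))
  have hule : ∀ ω a, v ω - M.next v ω a = 0 →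
      0 ≤ M.next v ω a + u ω - M.g ω a - M.next u ω a := by
    intro ω a h0
    have hfr : ∃ᶠ k in atTop, 0 ≤ (M.next v ω a + u ω - M.g ω a - M.next u ω a) +
        (M.next u ω a + 2 * C) * ε k := by
      refine (hkey ω a).mono fun k hk => ?_
      rw [h0] at hk
      refine nonneg_of_mul_nonneg_left (b := ε k) ?_ (hε0 k)
      linarith
    refine ge_of_tendsto_of_frequently (f := fun k => _) ?_ hfr
    simpa using tendsto_const_nhds.add (hεlim.const_mul (M.next u ω a + 2 * C))
  have hK : ∀ᶠ K : ℝ in atTop, ∀ ω a, 0 ≤ v ω + u ω - M.g ω a - M.next u ω a +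
      K * (v ω - M.next v ω a) := by
    refine eventually_all.mpr fun ω => eventually_all.mpr fun a => ?_
    rcases (hvle ω a).eq_or_lt with h0 | h0
    · refine Eventually.of_forall fun K => ?_
      have := hule ω a h0.symm
      rw [← h0]
      linarith
    · have := (tendsto_id.atTop_mul_const h0).eventually_ge_atTop
        (-(v ω + u ω - M.g ω a - M.next u ω a))
      filter_upwards [this] with K hK
      simp only [id] at hK
      linarith
  obtain ⟨K, hK⟩ := hK.exists
  have hvd : ∀ ω, M.next v ω (d ω) = v ω := fun ω => congrFun hv ω
  refine ⟨v, u + K • v, d, fun ω a => by linarith [hvle ω a], fun ω a => ?_, hvd, fun ω => ?_⟩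
  · rw [next_add, next_smul]
    simp only [Pi.add_apply, Pi.smul_apply, smul_eq_mul]
    linarith [hK ω a]
  · rw [next_add, next_smul, hvd]
    simp only [Pi.add_apply, Pi.smul_apply, smul_eq_mul]
    have : v ω + u ω = M.g ω (d ω) + M.next u ω (d ω) := congrFun hu ω
    linarith

end Bellman

section Expectation

variable {Ω A S : Type*} [Fintype Ω] [Fintype A]

/-- The expectation under `σ` of a function of the state and action at stage `n + 1`. -/
noncomputable def expect (M : POMDP Ω A S) (σ : Strategy S A) (n : ℕ) (φ : Ω → A → ℝ) : ℝ :=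
  ∑ tr : Fin (n + 1) → Ω × A, M.trajP σ (List.ofFn tr) * φ (tr 0).1 (tr 0).2

theorem expect_add (M : POMDP Ω A S) (σ : Strategy S A) (n : ℕ) (φ ψ : Ω → A → ℝ) :
    M.expect σ n (fun ω a => φ ω a + ψ ω a) = M.expect σ n φ + M.expect σ n ψ := by
  simp [expect, mul_add, Finset.sum_add_distrib]

variable {M : POMDP Ω A S} {σ : Strategy S A}

theorem IsValid.trajP_nonneg (hM : M.IsValid) (hσ : IsStrategy σ) (l : List (Ω × A)) :
    0 ≤ M.trajP σ l := by
  induction l with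
  | nil => simp [trajP]
  | cons x rest ih =>
    obtain ⟨ω, a⟩ := x
    rw [trajP.eq_def]
    refine mul_nonneg (mul_nonneg ?_ (hσ.1 _ _)) ih
    cases rest with
    | nil => exact hM.2.2.1 ω
    | cons y _ => exact hM.1 _ _ _

theorem IsValid.expect_mono (hM : M.IsValid) (hσ : IsStrategy σ) (n : ℕ) {φ ψ : Ω → A → ℝ}
    (h : ∀ ω a, φ ω a ≤ ψ ω a) : M.expect σ n φ ≤ M.expect σ n ψ :=
  Finset.sum_le_sum fun _ _ => mul_le_mul_of_nonneg_left (h _ _) (hM.trajP_nonneg hσ _)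

theorem expect_zero_state (hσ : IsStrategy σ) (F : Ω → ℝ) :
    M.expect σ 0 (fun ω _ => F ω) = ∑ ω, M.p1 ω * F ω := by
  rw [expect, ← (Equiv.funUnique (Fin 1) (Ω × A)).symm.sum_comp, Fintype.sum_prod_type]
  refine Finset.sum_congr rfl fun ω _ => ?_
  simp [trajP, ← Finset.sum_mul, ← Finset.mul_sum, hσ.2]

theorem expect_succ_state (hσ : IsStrategy σ) (n : ℕ) (F : Ω → ℝ) :
    M.expect σ (n + 1) (fun ω _ => F ω) = M.expect σ n (M.next F) := by
  rw [expect, ← (Fin.consEquiv fun _ : Fin (n + 2) => Ω × A).sum_comp, Fintype.sum_prod_type_right]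
  refine Finset.sum_congr rfl fun tr _ => ?_
  rw [Fintype.sum_prod_type, next, Finset.mul_sum]
  refine Finset.sum_congr rfl fun ω _ => ?_
  have hl : List.ofFn tr = tr 0 :: List.ofFn (fun i : Fin n => tr i.succ) := List.ofFn_succ
  have : ∀ a, M.trajP σ (List.ofFn (Fin.cons (ω, a) tr : Fin (n + 2) → Ω × A)) =
      M.P (tr 0).1 (tr 0).2 ω * σ (M.obs (List.ofFn tr) ω) a * M.trajP σ (List.ofFn tr) := by
    intro a
    rw [List.ofFn_cons, hl]
    rfl
  change ∑ a, M.trajP σ (List.ofFn (Fin.cons (ω, a) tr : Fin (n + 2) → Ω × A)) * F ω = _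
  simp only [this]
  rw [← Finset.sum_mul, ← Finset.sum_mul, ← Finset.mul_sum, hσ.2]
  ring

theorem IsValid.expect_const (hM : M.IsValid) (hσ : IsStrategy σ) (n : ℕ) (c : ℝ) :
    M.expect σ n (fun _ _ => c) = c := by
  induction n with
  | zero => rw [expect_zero_state hσ fun _ => c, ← Finset.sum_mul, hM.2.2.2, one_mul]
  | succ n ih =>
    rw [expect_succ_state hσ n fun _ => c]
    have : M.next (fun _ => c) = fun _ _ => c := by
      funext ω a
      rw [next, ← Finset.sum_mul, hM.2.1, one_mul]
    rw [this, ih]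

theorem IsValid.abs_expect_le (hM : M.IsValid) (hσ : IsStrategy σ) (n : ℕ) {φ : Ω → A → ℝ} {C : ℝ}
    (h : ∀ ω a, |φ ω a| ≤ C) : |M.expect σ n φ| ≤ C := by
  rw [abs_le]
  constructor
  · rw [← hM.expect_const hσ n (-C)]
    exact hM.expect_mono hσ n fun ω a => (abs_le.mp (h ω a)).1
  · calc M.expect σ n φ ≤ M.expect σ n fun _ _ => C :=
        hM.expect_mono hσ n fun ω a => (abs_le.mp (h ω a)).2
      _ = C := hM.expect_const hσ n C

variable {v u : Ω → ℝ} {d : Ω → A}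

theorem IsAverageSolution.expect_le (hs : M.IsAverageSolution v u d) (hM : M.IsValid)
    (hσ : IsStrategy σ) (n : ℕ) :
    M.expect σ n (fun ω _ => v ω) ≤ ∑ ω, M.p1 ω * v ω := by
  induction n with
  | zero => exact (expect_zero_state hσ v).le
  | succ n ih =>
    rw [expect_succ_state hσ]
    exact (hM.expect_mono hσ n hs.next_le).trans ih

theorem IsAverageSolution.sum_stageE_le (hs : M.IsAverageSolution v u d) (hM : M.IsValid)
    (hσ : IsStrategy σ) (T : ℕ) :
    ∑ n ∈ Finset.range T, M.stageE σ n ≤ T * (∑ ω, M.p1 ω * v ω) +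
      (M.expect σ 0 (fun ω _ => u ω) - M.expect σ T (fun ω _ => u ω)) := by
  induction T with
  | zero => simp
  | succ T ih =>
    have h1 : M.stageE σ T + M.expect σ T (M.next u) ≤
        M.expect σ T (fun ω _ => v ω) + M.expect σ T (fun ω _ => u ω) := by
      rw [← expect_add]
      exact (expect_add M σ T M.g (M.next u)).ge.trans (hM.expect_mono hσ T hs.add_next_le)
    rw [Finset.sum_range_succ, expect_succ_state hσ]
    push_cast
    linarith [hs.expect_le hM hσ T]

/-- Under full observation, expectations under the strategy that plays `d ω` in state `ω` only
involve the actions prescribed by `d`. -/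
theorem expect_stationary {M : POMDP Ω A Ω} [DecidableEq A] (hf : M.f = id) (n : ℕ)
    (φ : Ω → A → ℝ) :
    M.expect (fun η a => if a = d η.2 then 1 else 0) n φ =
      M.expect (fun η a => if a = d η.2 then 1 else 0) n (fun ω _ => φ ω (d ω)) := by
  refine Finset.sum_congr rfl fun tr _ => ?_
  rw [List.ofFn_succ]
  obtain ⟨ω, a⟩ := tr 0
  by_cases h : a = d ω
  · rw [h]
  · simp [trajP, obs, hf, h]

theorem IsAverageSolution.sum_stageE_eq {M : POMDP Ω A Ω} [DecidableEq A]
    (hs : M.IsAverageSolution v u d) (hf : M.f = id)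
    (hσ : IsStrategy fun (η : Hist Ω A) a => if a = d η.2 then (1 : ℝ) else 0) (T : ℕ) :
    ∑ n ∈ Finset.range T, M.stageE (fun η a => if a = d η.2 then 1 else 0) n =
      T * (∑ ω, M.p1 ω * v ω) +
        (M.expect (fun η a => if a = d η.2 then 1 else 0) 0 (fun ω _ => u ω) -
          M.expect (fun η a => if a = d η.2 then 1 else 0) T (fun ω _ => u ω)) := by
  set σ : Strategy Ω A := fun η a => if a = d η.2 then 1 else 0 with hσdef
  have hv : ∀ n, M.expect σ n (fun ω _ => v ω) = ∑ ω, M.p1 ω * v ω := by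
    intro n
    induction n with
    | zero => exact expect_zero_state hσ v
    | succ n ih =>
      rw [expect_succ_state hσ, expect_stationary hf]
      simp only [hs.next_eq]
      exact ih
  induction T with
  | zero => simp
  | succ T ih =>
    have h1 : M.stageE σ T + M.expect σ T (M.next u) =
        M.expect σ T (fun ω _ => v ω) + M.expect σ T (fun ω _ => u ω) := by
      rw [← expect_add]
      refine (expect_add M σ T M.g (M.next u)).symm.trans ?_
      rw [expect_stationary hf]
      simp only [hs.add_next_eq]
      rfl
    rw [Finset.sum_range_succ, expect_succ_state hσ, ih]
    push_cast
    linarith [hv T]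

/-- A solution of the average-payoff optimality equations determines the optimal long-run average
payoff under full observation. -/
theorem IsAverageSolution.isGreatest {M : POMDP Ω A Ω} (hs : M.IsAverageSolution v u d)
    (hM : M.IsValid) (hf : M.f = id) :
    IsGreatest {r | ∃ σ : Strategy Ω A, IsStrategy σ ∧ r = M.R σ} (∑ ω, M.p1 ω * v ω) := by
  classical
  set c := ∑ ω, M.p1 ω * v ω
  have hu : ∀ {σ : Strategy Ω A}, IsStrategy σ → ∀ n,
      |M.expect σ n (fun ω _ => u ω)| ≤ ‖u‖ := fun hσ n =>
    hM.abs_expect_le hσ n fun ω _ => norm_le_pi_norm u ω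
  have hlim : ∀ b : ℝ, Tendsto (fun T : ℕ => c + b / (T : ℝ)) atTop (nhds c) := fun b => by
    simpa using tendsto_const_nhds.add (tendsto_const_div_atTop_nhds_zero_nat b)
  constructor
  · have hσ : IsStrategy fun (η : Hist Ω A) a => if a = d η.2 then (1 : ℝ) else 0 :=
      ⟨fun η a => by positivity, fun η => by simp⟩
    refine ⟨_, hσ, ?_⟩
    symm
    refine Tendsto.liminf_eq ?_
    refine tendsto_of_tendsto_of_tendsto_of_le_of_le' (hlim (-(2 * ‖u‖))) (hlim (2 * ‖u‖)) ?_ ?_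
    all_goals
      filter_upwards [eventually_gt_atTop 0] with T hT
      have hT' : (0 : ℝ) < T := Nat.cast_pos.mpr hT
      have h0 := abs_le.mp (hu hσ 0)
      have h1 := abs_le.mp (hu hσ T)
      rw [hs.sum_stageE_eq hf hσ, one_div_mul_eq_div, add_div, mul_div_cancel_left₀ _ hT'.ne']
      gcongr
      linarith
  · rintro _ ⟨σ, hσ, rfl⟩
    have hle : ∀ᶠ T : ℕ in atTop,
        1 / (T : ℝ) * ∑ n ∈ Finset.range T, M.stageE σ n ≤ c + 2 * ‖u‖ / T := by
      filter_upwards [eventually_gt_atTop 0] with T hT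
      have hT' : (0 : ℝ) < T := Nat.cast_pos.mpr hT
      have h0 := abs_le.mp (hu hσ 0)
      have h1 := abs_le.mp (hu hσ T)
      have h2 := hs.sum_stageE_le hM hσ T
      have h3 : c + 2 * ‖u‖ / T = (T * c + 2 * ‖u‖) / T := by
        rw [add_div, mul_div_cancel_left₀ _ hT'.ne']
      rw [h3, one_div_mul_eq_div]
      gcongr
      linarith
    have hbdd : IsBoundedUnder (· ≥ ·) atTop
        fun T : ℕ => 1 / (T : ℝ) * ∑ n ∈ Finset.range T, M.stageE σ n := by
      refine isBoundedUnder_of_eventually_ge (a := -‖M.g‖) ?_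
      filter_upwards [eventually_gt_atTop 0] with T hT
      have hT' : (0 : ℝ) < T := Nat.cast_pos.mpr hT
      have hg : ∀ n, -‖M.g‖ ≤ M.stageE σ n := fun n =>
        (abs_le.mp (hM.abs_expect_le hσ n fun ω a =>
          (norm_le_pi_norm (M.g ω) a).trans (norm_le_pi_norm M.g ω))).1
      rw [one_div_mul_eq_div, le_div_iff₀ hT']
      have := Finset.card_nsmul_le_sum (Finset.range T) _ _ fun n _ => hg n
      simpa [mul_comm] using this
    calc M.R σ ≤ liminf (fun T : ℕ => c + 2 * ‖u‖ / (T : ℝ)) atTop :=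
        liminf_le_liminf hle hbdd (hlim _).isCoboundedUnder_ge
      _ = c := (hlim _).liminf_eq

end Expectation

end POMDP

/-- If the signal fully reveals the state (`S = Ω`, `f = id`),
then `V(h) = V(1)` for every `h ∈ (0,1]`. -/
theorem value_constant_full_observation {Ω A : Type*} [Fintype Ω] [Fintype A] [DecidableEq Ω]
    (M : POMDP Ω A Ω) (hM : M.IsValid) (hf : M.f = id) :
    ∀ h ∈ Set.Ioc (0 : ℝ) 1, M.V h = M.V 1 := by
  intro h hh
  rcases isEmpty_or_nonempty A with hA | hA
  · obtain ⟨ω⟩ : Nonempty Ω := by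
      by_contra hΩ
      rw [not_nonempty_iff] at hΩ
      simpa using hM.2.2.2
    have hno : ∀ σ : Strategy Ω A, ¬ IsStrategy σ := fun σ hσ => by
      simpa using hσ.2 ([], ω)
    simp [POMDP.V, hno]
  · obtain ⟨v, u, d, hs⟩ := hM.exists_isAverageSolution
    have hV : ∀ k ∈ Set.Ioc (0 : ℝ) 1, M.V k = ∑ ω, M.p1 ω * v ω := fun k hk =>
      ((hs.dur hk.1).isGreatest (hM.dur hk) hf).csSup_eq
    rw [hV h hh, hV 1 ⟨one_pos, le_rfl⟩]
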